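/- arXiv:2204.01610 — 4 statements merged into one kernel-verified Lean document; each statement's English description precedes it below -/
import Mathlib

section
/- For integers k ≥ 2, n ≥ 2, 1 ≤ M ≤ kn−1, 1 ≤ j ≤ n−1 and 1 ≤ l ≤ k, whenever the event A^{(n)}_{M,j,l} has positive probability, the conditional probability under P_{n,k} that strategy S⁺(n,k;M) succeeds given A^{(n)}_{M,j,l} equals 1/(n−j). Moreover, for j = n and any 1 ≤ l ≤ k, the conditional probability of success of S⁺(n,k;M) given A^{(n)}_{M,n,l} equals 0. -/
open Finset Filter

open scoped Classical

/-- The sample space `Ω_{n,k}`: sequences of length `k*n` with values in `Fin n`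
(the value `v : Fin n` encodes the rank `v+1`), in which each value appears exactly `k`
times; these are the permutations of the multiset `{1^k, 2^k, …, n^k}`. -/
def multisetPerms (n k : ℕ) : Finset (Fin (k*n) → Fin n) :=
  Finset.univ.filter (fun w => ∀ v : Fin n, (Finset.univ.filter (fun i => w i = v)).card = k)

/-- The maximum (as a `0`-based value) among the first `M` entries of `w`. -/
def firstMax (n k M : ℕ) (w : Fin (k*n) → Fin n) : ℕ :=
  (Finset.univ.filter (fun t : Fin (k*n) => (t : ℕ) < M)).sup (fun t => (w t : ℕ))

/-- The strategy `S(n,k;M)` succeeds on `w`: there is an index `i` beyond the first `M`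
entries whose value is `≥` the maximum of the first `M` entries, and the first such index
carries an item of the highest rank `n`. -/
def succeedsS (n k M : ℕ) (w : Fin (k*n) → Fin n) : Prop :=
  ∃ i : Fin (k*n), M ≤ (i : ℕ) ∧ firstMax n k M w ≤ (w i : ℕ) ∧
    (∀ i' : Fin (k*n), M ≤ (i' : ℕ) → firstMax n k M w ≤ (w i' : ℕ) → i ≤ i') ∧
    (w i : ℕ) + 1 = n

/-- The strategy `S⁺(n,k;M)` succeeds on `w`: there is an index `i` beyond the first `M`
entries whose value is strictly greater than the maximum of the first `M` entries, and the
first such index carries an item of the highest rank `n`. -/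
def succeedsSplus (n k M : ℕ) (w : Fin (k*n) → Fin n) : Prop :=
  ∃ i : Fin (k*n), M ≤ (i : ℕ) ∧ firstMax n k M w < (w i : ℕ) ∧
    (∀ i' : Fin (k*n), M ≤ (i' : ℕ) → firstMax n k M w < (w i' : ℕ) → i ≤ i') ∧
    (w i : ℕ) + 1 = n

/-- `P_{n,k}(S(n,k;M))`: the probability of success of strategy `S(n,k;M)` under the
uniform measure on `Ω_{n,k}`. -/
noncomputable def probS (n k M : ℕ) : ℝ :=
  (((multisetPerms n k).filter (succeedsS n k M)).card : ℝ) / ((multisetPerms n k).card : ℝ)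

/-- `P_{n,k}(S⁺(n,k;M))`: the probability of success of strategy `S⁺(n,k;M)` under the
uniform measure on `Ω_{n,k}`. -/
noncomputable def probSplus (n k M : ℕ) : ℝ :=
  (((multisetPerms n k).filter (succeedsSplus n k M)).card : ℝ) / ((multisetPerms n k).card : ℝ)

/-- The event `A^{(n)}_{M,j,l}`: among the first `M` entries, the rank `j` appears exactly
`l` times and no rank greater than `j` appears. -/
def eventA (n k M j l : ℕ) (w : Fin (k*n) → Fin n) : Prop :=
  ((Finset.univ.filter (fun i : Fin (k*n) => (i : ℕ) < M ∧ (w i : ℕ) + 1 = j)).card = l) ∧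
  ∀ i : Fin (k*n), (i : ℕ) < M → (w i : ℕ) + 1 ≤ j

/-- The first entry of `w` whose `0`-based value is at least `j` equals `v`. -/
def FirstAbove {n N : ℕ} (j : ℕ) (w : Fin N → Fin n) (v : Fin n) : Prop :=
  ∃ i, w i = v ∧ j ≤ (w i : ℕ) ∧ ∀ i', j ≤ (w i' : ℕ) → i ≤ i'

lemma firstMax_of_eventA {n k M j l : ℕ} {w : Fin (k*n) → Fin n} (hl : 1 ≤ l)
    (h : eventA n k M j l w) : firstMax n k M w + 1 = j := by
  obtain ⟨h1, h2⟩ := h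
  have hpos : 0 < (Finset.univ.filter
      (fun i : Fin (k*n) => (i : ℕ) < M ∧ (w i : ℕ) + 1 = j)).card := by omega
  obtain ⟨i, hi⟩ := Finset.card_pos.mp hpos
  simp only [Finset.mem_filter, Finset.mem_univ, true_and] at hi
  have hle : (w i : ℕ) ≤ firstMax n k M w :=
    Finset.le_sup (f := fun t => (w t : ℕ)) (by simpa using hi.1)
  have hge : firstMax n k M w ≤ j - 1 := Finset.sup_le fun t ht => by
    have := h2 t (by simpa using ht)
    omega
  omega

lemma succeedsSplus_iff_firstAbove {n k M j l : ℕ} {w : Fin (k*n) → Fin n} (hl : 1 ≤ l)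
    (h : eventA n k M j l w) (v : Fin n) (hv : (v : ℕ) + 1 = n) :
    succeedsSplus n k M w ↔ FirstAbove j w v := by
  have hm := firstMax_of_eventA hl h
  have hM : ∀ i : Fin (k*n), j ≤ (w i : ℕ) → M ≤ (i : ℕ) := fun i hi => by
    by_contra hlt
    have := h.2 i (by omega)
    omega
  constructor
  · rintro ⟨i, -, hgt, hfirst, htop⟩
    exact ⟨i, Fin.ext (by omega), by omega,
      fun i' hi' => hfirst i' (hM i' hi') (by omega)⟩
  · rintro ⟨i, rfl, hgt, hfirst⟩
    exact ⟨i, hM i hgt, by omega, fun i' _ hi' => hfirst i' (by omega), hv⟩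

lemma existsUnique_firstAbove {n N j : ℕ} {w : Fin N → Fin n} (h : ∃ i, j ≤ (w i : ℕ)) :
    ∃! v, FirstAbove j w v := by
  obtain ⟨i, hi⟩ := h
  obtain ⟨m, hm, hmin⟩ := (Finset.univ.filter fun i => j ≤ (w i : ℕ)).exists_min_image id
    ⟨i, by simpa using hi⟩
  simp only [Finset.mem_filter, Finset.mem_univ, true_and, id] at hm hmin
  refine ⟨w m, ⟨m, rfl, hm, hmin⟩, ?_⟩
  rintro v ⟨i', rfl, hi', hmin'⟩
  rw [le_antisymm (hmin' m hm) (hmin i' hi')]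

lemma swap_val_lt {n j : ℕ} {u v : Fin n} (hu : j ≤ (u : ℕ)) (hv : j ≤ (v : ℕ)) {x : Fin n}
    (hx : (x : ℕ) < j) : Equiv.swap u v x = x :=
  Equiv.swap_apply_of_ne_of_ne (by rintro rfl; omega) (by rintro rfl; omega)

lemma le_swap_val {n j : ℕ} {u v : Fin n} (hu : j ≤ (u : ℕ)) (hv : j ≤ (v : ℕ)) (x : Fin n) :
    j ≤ (Equiv.swap u v x : ℕ) ↔ j ≤ (x : ℕ) := by
  rw [Equiv.swap_apply_def]
  split_ifs <;> simp_all

lemma swap_comp_mem_multisetPerms {n k : ℕ} {w : Fin (k*n) → Fin n} (u v : Fin n)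
    (hw : w ∈ multisetPerms n k) : (fun i => Equiv.swap u v (w i)) ∈ multisetPerms n k := by
  simp only [multisetPerms, Finset.mem_filter, Finset.mem_univ, true_and] at hw ⊢
  intro x
  refine Eq.trans (congrArg Finset.card ?_) (hw (Equiv.swap u v x))
  ext i
  simp [Equiv.swap_apply_eq_iff]

lemma eventA_swap_comp {n k M j l : ℕ} {w : Fin (k*n) → Fin n} {u v : Fin n}
    (hu : j ≤ (u : ℕ)) (hv : j ≤ (v : ℕ)) (hw : eventA n k M j l w) :
    eventA n k M j l (fun i => Equiv.swap u v (w i)) := by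
  have hfix : ∀ i : Fin (k*n), (i : ℕ) < M → Equiv.swap u v (w i) = w i := fun i hi =>
    swap_val_lt hu hv (by have := hw.2 i hi; omega)
  refine ⟨?_, fun i hi => by simpa only [hfix i hi] using hw.2 i hi⟩
  rw [← hw.1]
  congr 1
  ext i
  simp only [Finset.mem_filter, Finset.mem_univ, true_and]
  exact and_congr_right fun hi => by rw [hfix i hi]

lemma firstAbove_swap_comp {n N j : ℕ} {w : Fin N → Fin n} {u v : Fin n}
    (hu : j ≤ (u : ℕ)) (hv : j ≤ (v : ℕ)) (hw : FirstAbove j w u) :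
    FirstAbove j (fun i => Equiv.swap u v (w i)) v := by
  obtain ⟨i, hi, hle, hmin⟩ := hw
  exact ⟨i, by simp [hi], (le_swap_val hu hv _).2 hle,
    fun i' hi' => hmin i' ((le_swap_val hu hv _).1 hi')⟩

lemma card_firstAbove_le {n k M j l : ℕ} {u v : Fin n}
    (hu : j ≤ (u : ℕ)) (hv : j ≤ (v : ℕ)) :
    (((multisetPerms n k).filter (eventA n k M j l)).filter (fun w => FirstAbove j w u)).card ≤
    (((multisetPerms n k).filter (eventA n k M j l)).filter (fun w => FirstAbove j w v)).card := by
  refine Finset.card_le_card_of_injOn (fun w i => Equiv.swap u v (w i)) ?_ ?_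
  · intro w hw
    simp only [Finset.coe_filter, Finset.mem_filter, Set.mem_ofPred_eq] at hw ⊢
    exact ⟨⟨swap_comp_mem_multisetPerms u v hw.1.1, eventA_swap_comp hu hv hw.1.2⟩,
      firstAbove_swap_comp hu hv hw.2⟩
  · intro w _ w' _ h
    funext i
    exact (Equiv.swap u v).injective (congrFun h i)

lemma card_eventA_eq_mul {n k M j l : ℕ} (hk : 1 ≤ k) {v : Fin n}
    (hv : j ≤ (v : ℕ)) :
    ((multisetPerms n k).filter (eventA n k M j l)).card = (n - j) *
    (((multisetPerms n k).filter (eventA n k M j l)).filter (fun w => FirstAbove j w v)).card := by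
  have hV : (Finset.univ.filter fun u : Fin n => j ≤ (u : ℕ)).card = n - j := by
    have h := Fin.card_Ici (⟨j, lt_of_le_of_lt hv v.2⟩ : Fin n)
    rw [← h]
    congr 1
    ext u
    simp [Fin.le_def]
  rw [← hV, ← mul_one ((multisetPerms n k).filter (eventA n k M j l)).card]
  refine Finset.card_mul_eq_card_mul (FirstAbove j) (fun w hw => ?_) (fun u hu => ?_)
  · simp only [multisetPerms, Finset.mem_filter, Finset.mem_univ, true_and] at hw
    have hex : ∃ i, j ≤ (w i : ℕ) := by
      obtain ⟨i, hi⟩ := Finset.card_pos.mp (by rw [hw.1 v]; omega :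
        0 < (Finset.univ.filter fun i => w i = v).card)
      exact ⟨i, by rw [(Finset.mem_filter.mp hi).2]; exact hv⟩
    obtain ⟨x, hx, huniq⟩ := existsUnique_firstAbove hex
    refine Finset.card_eq_one.mpr ⟨x, Finset.ext fun y => ?_⟩
    simp only [Finset.bipartiteAbove, Finset.mem_filter, Finset.mem_univ, true_and,
      Finset.mem_singleton]
    refine ⟨fun hy => huniq y hy.2, ?_⟩
    rintro rfl
    obtain ⟨i, rfl, hle, -⟩ := id hx
    exact ⟨hle, hx⟩
  · have hu' : j ≤ (u : ℕ) := by simpa using hu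
    exact le_antisymm (card_firstAbove_le hu' hv) (card_firstAbove_le hv hu')

/-- Equations (4.1) and (4.2): conditional success probabilities of `S⁺(n,k;M)` given
`A^{(n)}_{M,j,l}`. -/
theorem secretary_multirank_condprob_plus (n k M : ℕ) (hk : 2 ≤ k) (hn : 2 ≤ n)
    (hM1 : 1 ≤ M) (hM2 : M ≤ k*n - 1) :
    (∀ j l : ℕ, 1 ≤ j → j ≤ n - 1 → 1 ≤ l → l ≤ k →
      0 < ((multisetPerms n k).filter (eventA n k M j l)).card →
      (((multisetPerms n k).filter
            (fun w => succeedsSplus n k M w ∧ eventA n k M j l w)).card : ℝ)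
          / (((multisetPerms n k).filter (eventA n k M j l)).card : ℝ)
        = 1 / ((n : ℝ) - (j : ℝ))) ∧
    (∀ l : ℕ, 1 ≤ l → l ≤ k →
      0 < ((multisetPerms n k).filter (eventA n k M n l)).card →
      (((multisetPerms n k).filter
            (fun w => succeedsSplus n k M w ∧ eventA n k M n l w)).card : ℝ)
          / (((multisetPerms n k).filter (eventA n k M n l)).card : ℝ) = 0) := by
  refine ⟨fun j l _ hjn hl _ hpos => ?_, fun l hl _ _ => ?_⟩
  · let v : Fin n := ⟨n - 1, by omega⟩
    have hv : (v : ℕ) + 1 = n := Nat.sub_add_cancel (by omega)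
    have hfilter : (multisetPerms n k).filter
        (fun w => succeedsSplus n k M w ∧ eventA n k M j l w) =
        ((multisetPerms n k).filter (eventA n k M j l)).filter (fun w => FirstAbove j w v) := by
      ext w
      simp only [Finset.mem_filter, and_assoc]
      refine and_congr_right fun _ => ?_
      rw [and_comm]
      exact and_congr_right fun hA => succeedsSplus_iff_firstAbove hl hA v hv
    have hcard := card_eventA_eq_mul (M := M) (l := l) (by omega : 1 ≤ k)
      (by omega : j ≤ (v : ℕ))
    rw [hfilter]
    rw [hcard] at hpos ⊢
    have hc := Nat.pos_of_mul_pos_left hpos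
    rw [Nat.cast_mul, Nat.cast_sub (by omega), div_mul_cancel_right₀ (by exact_mod_cast hc.ne'),
      one_div]
  · rw [Finset.filter_false_of_mem]
    · simp
    · rintro w - ⟨⟨i, -, hgt, -, -⟩, hA⟩
      have := firstMax_of_eventA hl hA
      have := (w i).2
      omega
end

section
/- Let k ≥ 2 be an integer, let c ∈ (0,1), let (M_n) be a sequence of integers with 1 ≤ M_n ≤ kn−1 and M_n/(kn) → c, and write c_n = M_n/(kn). Then lim_{N→∞} limsup_{n→∞} k·Σ_{l=1}^{k} C(M_n,l)·(k)_l·Σ_{j=1}^{n−N} (k(j−1))_{M_n−l} / (kn)_{M_n} · 1/(k(n−j+1)−l) = 0, where any falling factorial (b)_a with a > b is interpreted as 0. -/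
open Finset Filter

open scoped Classical

theorem descFactorial_mul_pow_le {b m : ℕ} (h : b ≤ m) (a : ℕ) :
    b.descFactorial a * m ^ a ≤ m.descFactorial a * b ^ a := by
  induction a with
  | zero => simp
  | succ a ih =>
    have hstep : (b - a) * m ≤ (m - a) * b := by
      rw [Nat.sub_mul, Nat.sub_mul, Nat.mul_comm m b]
      exact Nat.sub_le_sub_left (Nat.mul_le_mul_left a h) _
    calc b.descFactorial (a + 1) * m ^ (a + 1)
        = ((b - a) * m) * (b.descFactorial a * m ^ a) := by
          rw [Nat.descFactorial_succ]; ring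
      _ ≤ ((m - a) * b) * (m.descFactorial a * b ^ a) := Nat.mul_le_mul hstep ih
      _ = m.descFactorial (a + 1) * b ^ (a + 1) := by
          rw [Nat.descFactorial_succ]; ring

theorem descFactorial_div_le_exp {b m a : ℕ} (h : b ≤ m) (hm : 0 < m) (ha : a ≤ m) :
    (b.descFactorial a : ℝ) / m.descFactorial a
      ≤ Real.exp (-(a * (((m : ℝ) - b) / m))) := by
  have hm' : (0 : ℝ) < m := by exact_mod_cast hm
  have hpos : (0 : ℝ) < m.descFactorial a := by
    exact_mod_cast Nat.descFactorial_pos.2 ha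
  have h1 : (b.descFactorial a : ℝ) / m.descFactorial a ≤ ((b : ℝ) / m) ^ a := by
    rw [div_pow, div_le_div_iff₀ hpos (by positivity), mul_comm ((b : ℝ) ^ a)]
    exact_mod_cast descFactorial_mul_pow_le h a
  have h2 : (b : ℝ) / m ≤ Real.exp (-(((m : ℝ) - b) / m)) := by
    have := Real.add_one_le_exp (-(((m : ℝ) - b) / m))
    have e : -(((m : ℝ) - b) / m) + 1 = b / m := by field_simp; ring
    rwa [e] at this
  calc _ ≤ ((b : ℝ) / m) ^ a := h1
    _ ≤ Real.exp (-(((m : ℝ) - b) / m)) ^ a := by gcongr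
    _ = _ := by rw [← Real.exp_nat_mul]; ring_nf

theorem choose_mul_descFactorial_div_le {M m k l : ℕ} (hM : M ≤ m) (hl : l ≤ m) :
    (M.choose l : ℝ) * k.descFactorial l / m.descFactorial l ≤ 2 ^ k := by
  have hpos : (0 : ℝ) < m.descFactorial l := by
    exact_mod_cast Nat.descFactorial_pos.2 hl
  rw [div_le_iff₀ hpos]
  have h : M.choose l * k.descFactorial l ≤ 2 ^ k * m.descFactorial l := by
    calc M.choose l * k.descFactorial l ≤ m.choose l * k.descFactorial l := by
          gcongr
      _ = k.choose l * m.descFactorial l := by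
          rw [Nat.descFactorial_eq_factorial_mul_choose, Nat.descFactorial_eq_factorial_mul_choose]
          ring
      _ ≤ 2 ^ k * m.descFactorial l := by
          gcongr
          exact Nat.choose_le_two_pow k l
  exact_mod_cast h

theorem secretary_summand_le {k n M l j N : ℕ} {c : ℝ} (hc : 0 < c) (hk : 1 ≤ k) (hlk : l ≤ k)
    (hM : M ≤ k * n) (hcM : (k : ℝ) + c * (k * n) ≤ M) (hj : 1 ≤ j) (hN : 1 ≤ N)
    (hjN : j + N ≤ n) :
    (M.choose l : ℝ) * (k.descFactorial l : ℝ) *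
      (((k * (j - 1)).descFactorial (M - l) : ℝ) / ((k * n).descFactorial M : ℝ)
        * (1 / (((k * (n - j + 1) : ℕ) : ℝ) - (l : ℝ))))
      ≤ 2 ^ k * (Real.exp (-c) ^ (n - j) * (1 / N)) := by
  obtain ⟨i, rfl⟩ : ∃ i, n = j + i := ⟨n - j, by omega⟩
  obtain ⟨b, rfl⟩ : ∃ b, j = b + 1 := ⟨j - 1, by omega⟩
  have hi : N ≤ i := by omega
  have hk' : (1 : ℝ) ≤ k := by exact_mod_cast hk
  have hlk' : (l : ℝ) ≤ k := by exact_mod_cast hlk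
  have hN' : (1 : ℝ) ≤ N := by exact_mod_cast hN
  have hi' : (N : ℝ) ≤ i := by exact_mod_cast hi
  have hkM : k ≤ M := by
    have hcn : 0 ≤ c * (k * ((b + 1 + i : ℕ) : ℝ)) := by positivity
    have : (k : ℝ) ≤ M := by linarith
    exact_mod_cast this
  have hlM : l ≤ M := hlk.trans hkM
  have e1 : b + 1 - 1 = b := by omega
  have e2 : b + 1 + i - (b + 1) = i := by omega
  rw [e1, e2]
  have hexp : k * (b + 1 + i) = k * b + k + k * i := by ring
  have hki : 1 ≤ k * i := Nat.mul_pos hk (by omega)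
  set m := k * (b + 1 + i) - l with hm
  have hmpos : 0 < m := by omega
  have hbm : k * b ≤ m := by omega
  have hmR : (m : ℝ) = k * b + k + k * i - l := by
    rw [hm, Nat.cast_sub (by omega), hexp]; push_cast; ring
  have hfac := Nat.descFactorial_mul_descFactorial (n := k * (b + 1 + i)) hlM
  rw [← hm] at hfac
  have hA := choose_mul_descFactorial_div_le (k := k) hM (hlM.trans hM)
  have hB := descFactorial_div_le_exp (a := M - l) hbm hmpos (by omega)
  have hmpos' : (0 : ℝ) < m := by exact_mod_cast hmpos
  have hE : Real.exp (-(((M - l : ℕ) : ℝ) * (((m : ℝ) - (k * b : ℕ)) / m)))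
      ≤ Real.exp (-c) ^ i := by
    rw [← Real.exp_nat_mul, Real.exp_le_exp]
    have h1 : c * m ≤ ((M - l : ℕ) : ℝ) := by
      rw [Nat.cast_sub hlM]
      have : (m : ℝ) ≤ k * ((b + 1 + i : ℕ) : ℝ) := by
        rw [hm]; exact_mod_cast Nat.sub_le _ _
      nlinarith
    have h2 : (i : ℝ) ≤ (m : ℝ) - (k * b : ℕ) := by
      rw [hmR]; push_cast; nlinarith
    have h3 : c * i ≤ ((M - l : ℕ) : ℝ) * (((m : ℝ) - (k * b : ℕ)) / m) := by
      calc c * i ≤ c * ((m : ℝ) - (k * b : ℕ)) := by gcongr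
        _ = c * m * (((m : ℝ) - (k * b : ℕ)) / m) := by field_simp
        _ ≤ _ := by
          gcongr
          exact div_nonneg (by linarith) hmpos'.le
    linarith
  have hD : 1 / (((k * (i + 1) : ℕ) : ℝ) - l) ≤ 1 / N := by
    apply one_div_le_one_div_of_le (by linarith)
    push_cast; nlinarith
  have hD0 : 0 ≤ 1 / (((k * (i + 1) : ℕ) : ℝ) - l) := by
    apply one_div_nonneg.2
    push_cast; nlinarith
  rw [← hfac]
  push_cast
  calc _ = ((M.choose l : ℝ) * k.descFactorial l / (k * (b + 1 + i)).descFactorial l) *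
        ((((k * b).descFactorial (M - l) : ℝ) / m.descFactorial (M - l)) *
          (1 / (((k * (i + 1) : ℕ) : ℝ) - l))) := by
        push_cast
        simp only [div_eq_mul_inv, mul_inv]
        ring
    _ ≤ _ := by
        gcongr
        exact hB.trans hE

theorem sum_pow_sub_le {q : ℝ} (hq0 : 0 ≤ q) (hq1 : q < 1) (n N : ℕ) :
    ∑ j ∈ Icc 1 (n - N), q ^ (n - j) ≤ 1 / (1 - q) := by
  calc ∑ j ∈ Icc 1 (n - N), q ^ (n - j) ≤ ∑ j ∈ range (n + 1), q ^ (n - j) := by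
        apply sum_le_sum_of_subset_of_nonneg
        · intro j hj
          simp only [mem_Icc, mem_range] at hj ⊢
          omega
        · intros; positivity
    _ = ∑ j ∈ range (n + 1), q ^ j := by
        simpa using sum_range_reflect (fun j => q ^ j) (n + 1)
    _ ≤ ∑' j, q ^ j := (summable_geometric_of_lt_one hq0 hq1).sum_le_tsum _
        (fun _ _ => by positivity)
    _ = 1 / (1 - q) := by rw [tsum_geometric_of_lt_one hq0 hq1, one_div]

theorem secretary_tail_sum_le {k n M N : ℕ} {c : ℝ} (hc : 0 < c) (hk : 1 ≤ k)
    (hM : M ≤ k * n) (hcM : (k : ℝ) + c * (k * n) ≤ M) (hN : 1 ≤ N) :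
    (k : ℝ) * ∑ l ∈ Icc 1 k, (M.choose l : ℝ) * (k.descFactorial l : ℝ) *
      ∑ j ∈ Icc 1 (n - N), ((k * (j - 1)).descFactorial (M - l) : ℝ)
        / ((k * n).descFactorial M : ℝ) * (1 / (((k * (n - j + 1) : ℕ) : ℝ) - (l : ℝ)))
      ≤ k * (k * (2 ^ k * (1 / (1 - Real.exp (-c))))) * (1 / N) := by
  have hq : Real.exp (-c) < 1 := by simpa using hc
  rw [mul_assoc]
  gcongr
  calc _ ≤ ∑ l ∈ Icc 1 k, 2 ^ k * (1 / (1 - Real.exp (-c))) * (1 / (N : ℝ)) := by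
        apply sum_le_sum
        intro l hl
        rw [mul_sum]
        calc _ ≤ ∑ j ∈ Icc 1 (n - N), 2 ^ k * (Real.exp (-c) ^ (n - j) * (1 / (N : ℝ))) := by
              apply sum_le_sum
              intro j hj
              rw [mem_Icc] at hl hj
              exact secretary_summand_le hc hk hl.2 hM hcM hj.1 hN (by omega)
          _ = 2 ^ k * (∑ j ∈ Icc 1 (n - N), Real.exp (-c) ^ (n - j)) * (1 / (N : ℝ)) := by
              rw [← mul_sum, ← sum_mul, mul_assoc]
          _ ≤ _ := by
              gcongr
              exact sum_pow_sub_le (Real.exp_pos _).le hq n N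
    _ = _ := by
        rw [sum_const, Nat.card_Icc, nsmul_eq_mul, Nat.add_sub_cancel]; ring

theorem secretary_tail_sum_nonneg (k n M N : ℕ) :
    0 ≤ (k : ℝ) * ∑ l ∈ Icc 1 k, (M.choose l : ℝ) * (k.descFactorial l : ℝ) *
      ∑ j ∈ Icc 1 (n - N), ((k * (j - 1)).descFactorial (M - l) : ℝ)
        / ((k * n).descFactorial M : ℝ) * (1 / (((k * (n - j + 1) : ℕ) : ℝ) - (l : ℝ))) := by
  refine mul_nonneg (by positivity) (sum_nonneg fun l hl => mul_nonneg (by positivity)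
    (sum_nonneg fun j _ => mul_nonneg (by positivity) (one_div_nonneg.2 (sub_nonneg.2 ?_))))
  exact_mod_cast (mem_Icc.1 hl).2.trans (Nat.le_mul_of_pos_right k (Nat.succ_pos _))

theorem eventually_const_add_mul_le {M : ℕ → ℕ} {k : ℕ} (hk : 1 ≤ k) {c : ℝ} (hc : 0 < c)
    (hlim : Tendsto (fun n : ℕ => (M n : ℝ) / ((k : ℝ) * n)) atTop (nhds c)) :
    ∀ᶠ n : ℕ in atTop, (k : ℝ) + c / 2 * (k * n) ≤ M n := by
  have hk' : (1 : ℝ) ≤ k := by exact_mod_cast hk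
  have h1 : ∀ᶠ n : ℕ in atTop, 3 * c / 4 < (M n : ℝ) / ((k : ℝ) * n) :=
    hlim.eventually_const_lt (by linarith)
  filter_upwards [h1, eventually_ge_atTop 1,
    tendsto_natCast_atTop_atTop.eventually_ge_atTop (4 / c)] with n h1 h2 h3
  have hn : (1 : ℝ) ≤ n := by exact_mod_cast h2
  rw [lt_div_iff₀ (by positivity)] at h1
  rw [div_le_iff₀ hc] at h3
  nlinarith

/-- Equation (3.6): the tail part of the sum is negligible. -/
theorem secretary_multirank_tail_negligible (k : ℕ) (hk : 2 ≤ k) (c : ℝ)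
    (hc : c ∈ Set.Ioo (0:ℝ) 1)
    (M : ℕ → ℕ) (hM : ∀ n, 1 ≤ n → 1 ≤ M n ∧ M n ≤ k*n - 1)
    (hlim : Tendsto (fun n : ℕ => (M n : ℝ) / ((k : ℝ) * n)) atTop (nhds c)) :
    Tendsto (fun N : ℕ =>
        Filter.limsup (fun n : ℕ =>
          (k : ℝ) * ∑ l ∈ Finset.Icc 1 k,
            ((M n).choose l : ℝ) * (Nat.descFactorial k l : ℝ) *
              ∑ j ∈ Finset.Icc 1 (n - N),
                (Nat.descFactorial (k*(j-1)) (M n - l) : ℝ)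
                    / (Nat.descFactorial (k*n) (M n) : ℝ)
                  * (1 / (((k*(n-j+1) : ℕ) : ℝ) - (l : ℝ)))) atTop)
      atTop (nhds 0) := by
  have hk1 : 1 ≤ k := by omega
  have hc0 : 0 < c / 2 := half_pos hc.1
  set K : ℝ := k * (k * (2 ^ k * (1 / (1 - Real.exp (-(c / 2)))))) with hK
  have hbound : ∀ N : ℕ, 1 ≤ N → ∀ᶠ n : ℕ in atTop, _ ≤ K * (1 / (N : ℝ)) := fun N hN => by
    filter_upwards [eventually_const_add_mul_le hk1 hc.1 hlim, eventually_ge_atTop 1] with n h1 h2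
    exact secretary_tail_sum_le hc0 hk1 ((hM n h2).2.trans (Nat.sub_le _ _)) h1 hN
  have hK0 : Tendsto (fun N : ℕ => K * (1 / (N : ℝ))) atTop (nhds 0) := by
    simpa using tendsto_one_div_atTop_nhds_zero_nat.const_mul K
  refine tendsto_of_tendsto_of_tendsto_of_le_of_le' tendsto_const_nhds hK0 ?_ ?_
  · filter_upwards [eventually_ge_atTop 1] with N hN
    exact le_limsup_of_frequently_le
      (Frequently.of_forall fun n => secretary_tail_sum_nonneg k n (M n) N)
      (isBoundedUnder_of_eventually_le (hbound N hN))
  · filter_upwards [eventually_ge_atTop 1] with N hN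
    exact limsup_le_of_le (isBoundedUnder_of_eventually_ge
      (Eventually.of_forall fun n => secretary_tail_sum_nonneg k n (M n) N)).isCoboundedUnder_le
      (hbound N hN)
end

section
/- Let k ≥ 2 be an integer, let c ∈ (0,1), and let (M_n) be a sequence of integers with 1 ≤ M_n ≤ kn−1 and M_n/(kn) → c. Then for each fixed integer s ≥ 0 and each 1 ≤ l ≤ k, lim_{n→∞} C(M_n,l)·(k(n−s−1))_{M_n−l} / (kn)_{M_n} = (1/l!)·(c/(1−c))^l·(1−c)^{k(s+1)}, where any falling factorial (b)_a with a > b is interpreted as 0. -/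
open Finset Filter

open scoped Classical

/-- If `u n / x n → a` and `x n → ∞`, the `j`-th falling factorial of `u n` is asymptotic to
`a ^ j * x n ^ j`. -/
theorem tendsto_descFactorial_div_pow {u : ℕ → ℕ} {x : ℕ → ℝ} {a : ℝ}
    (hx : Tendsto x atTop atTop) (hu : Tendsto (fun n => (u n : ℝ) / x n) atTop (nhds a)) (j : ℕ) :
    Tendsto (fun n => ((u n).descFactorial j : ℝ) / x n ^ j) atTop (nhds (a ^ j)) := by
  induction j with
  | zero => simp
  | succ j ih =>
    have hlower : Tendsto (fun n => (u n : ℝ) / x n - j / x n) atTop (nhds a) := by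
      simpa using hu.sub (hx.const_div_atTop (j : ℝ))
    have hsub : Tendsto (fun n => ((u n - j : ℕ) : ℝ) / x n) atTop (nhds a) := by
      refine tendsto_of_tendsto_of_tendsto_of_le_of_le' hlower hu ?_ ?_
      · filter_upwards [hx.eventually_gt_atTop 0] with n hn
        rw [← sub_div]
        gcongr
        rw [sub_le_iff_le_add]
        exact_mod_cast le_tsub_add
      · filter_upwards [hx.eventually_gt_atTop 0] with n hn
        gcongr
        exact Nat.sub_le _ _
    have h := hsub.mul ih
    rw [← pow_succ'] at h
    refine h.congr fun n => ?_
    rw [Nat.descFactorial_succ, Nat.cast_mul, pow_succ', mul_div_mul_comm]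

theorem Nat.descFactorial_sub_mul_descFactorial {N M d l : ℕ} (hlM : l ≤ M) (hld : l ≤ d) :
    (N - d).descFactorial (M - l) * N.descFactorial d =
      N.descFactorial M * (N - M).descFactorial (d - l) := by
  have h₁ := Nat.descFactorial_mul_descFactorial (n := N) (Nat.le_add_right d (M - l))
  have h₂ := Nat.descFactorial_mul_descFactorial (n := N) (Nat.le_add_right M (d - l))
  rw [Nat.add_sub_cancel_left] at h₁ h₂
  rw [h₁, mul_comm, h₂]
  congr 1
  omega

/-- Equation (3.11): the key limit. -/
theorem secretary_multirank_key_limit (k : ℕ) (hk : 2 ≤ k) (c : ℝ)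
    (hc : c ∈ Set.Ioo (0:ℝ) 1)
    (M : ℕ → ℕ) (hM : ∀ n, 1 ≤ n → 1 ≤ M n ∧ M n ≤ k*n - 1)
    (hlim : Tendsto (fun n : ℕ => (M n : ℝ) / ((k : ℝ) * n)) atTop (nhds c))
    (s l : ℕ) (hl1 : 1 ≤ l) (hl2 : l ≤ k) :
    Tendsto (fun n : ℕ =>
        ((M n).choose l : ℝ) * (Nat.descFactorial (k*(n-s-1)) (M n - l) : ℝ)
          / (Nat.descFactorial (k*n) (M n) : ℝ)) atTop
      (nhds ((1 / (l.factorial : ℝ)) * (c/(1-c))^l * (1-c)^(k*(s+1)))) := by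
  obtain ⟨hc0, hc1⟩ := hc
  have hk0 : (0 : ℝ) < k := by exact_mod_cast (by omega : 0 < k)
  have hx : Tendsto (fun n : ℕ => (k : ℝ) * n) atTop atTop :=
    tendsto_natCast_atTop_atTop.const_mul_atTop hk0
  have hld : l ≤ k * (s + 1) := hl2.trans (Nat.le_mul_of_pos_right k (Nat.succ_pos s))
  have hMle : ∀ n, 1 ≤ n → M n ≤ k * n := fun n hn => (hM n hn).2.trans (Nat.sub_le _ _)
  have hone : Tendsto (fun n : ℕ => ((k * n : ℕ) : ℝ) / ((k : ℝ) * n)) atTop (nhds 1) := by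
    refine tendsto_const_nhds.congr' ?_
    filter_upwards [hx.eventually_gt_atTop 0] with n hn
    rw [Nat.cast_mul, div_self hn.ne']
  have hcompl : Tendsto (fun n : ℕ => ((k * n - M n : ℕ) : ℝ) / ((k : ℝ) * n)) atTop
      (nhds (1 - c)) := by
    refine (hone.sub hlim).congr' ?_
    filter_upwards [eventually_ge_atTop 1] with n hn
    rw [Nat.cast_sub (hMle n hn), sub_div]
  have hMtop : Tendsto (fun n => (M n : ℝ)) atTop atTop := by
    refine (hlim.pos_mul_atTop hc0 hx).congr' ?_
    filter_upwards [hx.eventually_gt_atTop 0] with n hn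
    exact div_mul_cancel₀ _ hn.ne'
  have key := (((tendsto_descFactorial_div_pow hx hlim l).mul
    (tendsto_descFactorial_div_pow hx hcompl (k * (s + 1) - l))).div
    (tendsto_descFactorial_div_pow hx hone (k * (s + 1))) (by simp)).const_mul
    (1 / (l.factorial : ℝ))
  have hval : 1 / (l.factorial : ℝ) * (c ^ l * (1 - c) ^ (k * (s + 1) - l) / 1 ^ (k * (s + 1))) =
      1 / (l.factorial : ℝ) * (c / (1 - c)) ^ l * (1 - c) ^ (k * (s + 1)) := by
    have : (1 - c) ≠ 0 := by linarith
    rw [pow_sub₀ _ this hld, div_pow, one_pow]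
    field_simp
  rw [hval] at key
  refine key.congr' ?_
  filter_upwards [hx.eventually_gt_atTop 0, eventually_ge_atTop (s + 1),
    hMtop.eventually_ge_atTop (l : ℝ)] with n hn hsn hlM
  have hlM : l ≤ M n := by exact_mod_cast hlM
  have hid := Nat.descFactorial_sub_mul_descFactorial (N := k * n) hlM hld
  rw [← Nat.mul_sub, ← Nat.sub_sub] at hid
  have hid' : ((k * (n - s - 1)).descFactorial (M n - l) : ℝ) *
      ((k * n).descFactorial (k * (s + 1)) : ℝ) = ((k * n).descFactorial (M n) : ℝ) *
      ((k * n - M n).descFactorial (k * (s + 1) - l) : ℝ) := by exact_mod_cast hid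
  have hd : ((k * n).descFactorial (k * (s + 1)) : ℝ) ≠ 0 := by
    rw [Nat.cast_ne_zero, Ne, Nat.descFactorial_eq_zero_iff_lt, not_lt]
    exact Nat.mul_le_mul_left k hsn
  have hm : ((k * n).descFactorial (M n) : ℝ) ≠ 0 := by
    rw [Nat.cast_ne_zero, Ne, Nat.descFactorial_eq_zero_iff_lt, not_lt]
    exact hMle n (by omega)
  have hfac : ((M n).descFactorial l : ℝ) = l.factorial * (M n).choose l := by
    exact_mod_cast Nat.descFactorial_eq_factorial_mul_choose (M n) l
  have hl0 : (l.factorial : ℝ) ≠ 0 := by exact_mod_cast l.factorial_ne_zero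
  have hpow : ((k : ℝ) * n) ^ (k * (s + 1)) =
      ((k : ℝ) * n) ^ l * ((k : ℝ) * n) ^ (k * (s + 1) - l) := by
    rw [← pow_add, Nat.add_sub_cancel' hld]
  simp only [Pi.div_apply]
  rw [div_mul_div_comm ((M n).descFactorial l : ℝ), ← hpow,
    div_div_div_cancel_right₀ (pow_ne_zero _ hn.ne'), hfac,
    eq_div_of_mul_eq hd hid']
  field_simp
end

section
/- Let k ≥ 2 be an integer, let c ∈ (0,1), and let (M_n) be a sequence of integers with 1 ≤ M_n ≤ kn−1 and M_n/(kn) → c. Then lim_{n→∞} k·Σ_{j=1}^{n−1} Σ_{l=1}^{k} C(M_n,l)·(k)_l·(k(j−1))_{M_n−l} / (kn)_{M_n} · 1/(k(n−j+1)−l) = k·Σ_{l=1}^{k} C(k,l)·(c/(1−c))^l·Σ_{s=1}^{∞} (1−c)^{k(s+1)}/(k(s+1)−l), where any falling factorial (b)_a with a > b is interpreted as 0. -/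
open Finset Filter

open scoped Classical

lemma descFactorial_le_pow_mul_descFactorial {A B : ℕ} {r : ℝ} (hr0 : 0 ≤ r) (hr1 : r ≤ 1)
    (h : (A : ℝ) ≤ r * B) (a : ℕ) :
    (A.descFactorial a : ℝ) ≤ r ^ a * B.descFactorial a := by
  induction a with
  | zero => simp
  | succ a ih =>
    have hsub : ((A - a : ℕ) : ℝ) ≤ r * ((B - a : ℕ) : ℝ) := by
      rcases le_total a A with haA | haA
      · have hB : (B : ℝ) - a ≤ ((B - a : ℕ) : ℝ) := by
          rw [sub_le_iff_le_add]
          exact_mod_cast (by omega : B ≤ B - a + a)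
        rw [Nat.cast_sub haA]
        have h1 := mul_le_mul_of_nonneg_left hB hr0
        nlinarith [Nat.cast_nonneg (α := ℝ) a]
      · rw [Nat.sub_eq_zero_of_le haA]
        rw [Nat.cast_zero]
        positivity
    rw [Nat.descFactorial_succ, Nat.descFactorial_succ]
    push_cast
    calc ((A - a : ℕ) : ℝ) * A.descFactorial a
        ≤ (r * ((B - a : ℕ) : ℝ)) * (r ^ a * B.descFactorial a) := by gcongr
      _ = _ := by ring

lemma tendsto_descFactorial_div_pow_s13 {ι : Type*} {f : Filter ι} {A : ι → ℕ} {N : ι → ℝ} {α : ℝ}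
    (hN : Tendsto N f atTop) (hA : Tendsto (fun i => (A i : ℝ) / N i) f (nhds α)) (a : ℕ) :
    Tendsto (fun i => ((A i).descFactorial a : ℝ) / N i ^ a) f (nhds (α ^ a)) := by
  induction a with
  | zero => simpa using tendsto_const_nhds
  | succ a ih =>
    have hsub : Tendsto (fun i => ((A i - a : ℕ) : ℝ) / N i) f (nhds α) := by
      have hlow : Tendsto (fun i => (A i : ℝ) / N i - a / N i) f (nhds α) := by
        simpa using hA.sub (hN.const_div_atTop (a : ℝ))
      refine tendsto_of_tendsto_of_tendsto_of_le_of_le' hlow hA ?_ ?_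
      · filter_upwards [hN.eventually_gt_atTop 0] with i hi
        rw [← sub_div]
        gcongr
        rw [sub_le_iff_le_add]
        exact_mod_cast (by omega : A i ≤ A i - a + a)
      · filter_upwards [hN.eventually_gt_atTop 0] with i hi
        gcongr
        omega
    refine (pow_succ' α a ▸ hsub.mul ih).congr fun i => ?_
    rw [Nat.descFactorial_succ, pow_succ', Nat.cast_mul, mul_div_mul_comm]

lemma descFactorial_div_descFactorial_symm {N M m l : ℕ} (hm : m ≤ N) (hM : M ≤ N)
    (hlm : l ≤ m) (hlM : l ≤ M) :
    ((N - m).descFactorial (M - l) : ℝ) / N.descFactorial M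
      = (N - M).descFactorial (m - l) / N.descFactorial m := by
  have h1 : (N - m).descFactorial (M - l) * N.descFactorial m = N.descFactorial (m + M - l) := by
    rw [← Nat.descFactorial_mul_descFactorial (by omega : m ≤ m + M - l)]
    congr 2
    omega
  have h2 : (N - M).descFactorial (m - l) * N.descFactorial M = N.descFactorial (m + M - l) := by
    rw [← Nat.descFactorial_mul_descFactorial (by omega : M ≤ m + M - l)]
    congr 2
    omega
  have hne : ∀ a ≤ N, (N.descFactorial a : ℝ) ≠ 0 := fun a ha => by
    exact_mod_cast fun h => (Nat.descFactorial_eq_zero_iff_lt.mp h).not_ge ha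
  rw [div_eq_div_iff (hne M hM) (hne m hm)]
  exact_mod_cast h1.trans h2.symm

lemma choose_mul_descFactorial_comm (M k l : ℕ) :
    (M.choose l : ℝ) * k.descFactorial l = k.choose l * M.descFactorial l := by
  rw [Nat.descFactorial_eq_factorial_mul_choose, Nat.descFactorial_eq_factorial_mul_choose]
  push_cast
  ring

/-- The hypergeometric sum tends to the corresponding binomial series. -/
lemma tendsto_tsum_hypergeometric (k : ℕ) (hk : 2 ≤ k) (c : ℝ) (hc : c ∈ Set.Ioo (0:ℝ) 1)
    (M : ℕ → ℕ) (hM : ∀ᶠ n in atTop, M n ≤ k * n)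
    (hlim : Tendsto (fun n : ℕ => (M n : ℝ) / ((k : ℝ) * n)) atTop (nhds c))
    (l : ℕ) (hl : l ≤ k) :
    Tendsto (fun n : ℕ => ∑' s : ℕ, ((M n).descFactorial l : ℝ)
        * (k * n - M n).descFactorial (k * (s + 2) - l) / (k * n).descFactorial (k * (s + 2))
        * (1 / (((k * (s + 2) : ℕ) : ℝ) - l))) atTop
      (nhds (∑' s : ℕ, c ^ l * (1 - c) ^ (k * (s + 2) - l)
        * (1 / (((k * (s + 2) : ℕ) : ℝ) - l)))) := by
  obtain ⟨hc0, hc1⟩ := hc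
  have hkpos : (0 : ℝ) < k := by positivity
  have hN : Tendsto (fun n : ℕ => (k : ℝ) * n) atTop atTop :=
    tendsto_natCast_atTop_atTop.const_mul_atTop hkpos
  have hNM : Tendsto (fun n : ℕ => ((k * n - M n : ℕ) : ℝ) / ((k : ℝ) * n)) atTop
      (nhds (1 - c)) := by
    refine (hlim.const_sub 1).congr' ?_
    filter_upwards [hM, hN.eventually_gt_atTop 0] with n hn hpos
    rw [Nat.cast_sub hn, Nat.cast_mul, sub_div, div_self hpos.ne']
  have hNN : Tendsto (fun n : ℕ => ((k * n : ℕ) : ℝ) / ((k : ℝ) * n)) atTop (nhds 1) := by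
    refine tendsto_const_nhds.congr' ?_
    filter_upwards [hN.eventually_gt_atTop 0] with n hpos
    rw [Nat.cast_mul, div_self hpos.ne']
  have hlm : ∀ s, l + (s + 1) ≤ k * (s + 2) := fun s => by nlinarith
  have hden : ∀ s, (1 : ℝ) ≤ ((k * (s + 2) : ℕ) : ℝ) - l := fun s => by
    have h : ((l + (s + 1) : ℕ) : ℝ) ≤ ((k * (s + 2) : ℕ) : ℝ) := by exact_mod_cast hlm s
    push_cast at h ⊢
    linarith [Nat.cast_nonneg (α := ℝ) s]
  set r : ℝ := 1 - c / 2 with hr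
  have hr0 : 0 ≤ r := by linarith
  have hr1 : r < 1 := by linarith
  have hratio : ∀ᶠ n : ℕ in atTop, ((k * n - M n : ℕ) : ℝ) ≤ r * ((k * n - l : ℕ) : ℝ) := by
    have h : Tendsto (fun n : ℕ => ((k * n - M n : ℕ) : ℝ) / ((k : ℝ) * n)
        + r * l / ((k : ℝ) * n)) atTop (nhds (1 - c)) := by
      simpa using hNM.add (hN.const_div_atTop (r * l))
    filter_upwards [h.eventually_lt_const (show 1 - c < r by linarith),
      hN.eventually_gt_atTop 0] with n hn hpos
    rw [← add_div, div_lt_iff₀ hpos] at hn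
    have hsub : ((k * n : ℕ) : ℝ) - l ≤ ((k * n - l : ℕ) : ℝ) := by
      rw [sub_le_iff_le_add]
      exact_mod_cast (by omega : k * n ≤ k * n - l + l)
    have h1 := mul_le_mul_of_nonneg_left hsub hr0
    push_cast at h1
    nlinarith
  refine tendsto_tsum_of_dominated_convergence (bound := fun s => r ^ s)
    (summable_geometric_of_lt_one hr0 hr1) (fun s => ?_) ?_
  · refine Tendsto.mul_const _ ?_
    have h := ((tendsto_descFactorial_div_pow_s13 hN hlim l).mul
      (tendsto_descFactorial_div_pow_s13 hN hNM (k * (s + 2) - l))).div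
      (tendsto_descFactorial_div_pow_s13 hN hNN (k * (s + 2))) (by simp)
    rw [one_pow, div_one] at h
    refine h.congr' ?_
    filter_upwards [hN.eventually_gt_atTop 0] with n hpos
    have hsplit : ((k : ℝ) * n) ^ (k * (s + 2))
        = ((k : ℝ) * n) ^ l * ((k : ℝ) * n) ^ (k * (s + 2) - l) := by
      rw [← pow_add]
      congr 1
      have := hlm s
      omega
    simp only [Pi.div_apply]
    rw [← mul_div_mul_comm, ← hsplit, div_div_div_cancel_right₀ (by positivity)]
  · filter_upwards [hM, hratio] with n hn hrn s
    have hd := hden s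
    have hprob : ((M n).descFactorial l : ℝ) * (k * n - M n).descFactorial (k * (s + 2) - l)
        / (k * n).descFactorial (k * (s + 2)) ≤ r ^ s := by
      refine div_le_of_le_mul₀ (by positivity) (by positivity) ?_
      have hsl := hlm s
      have h1 : ((M n).descFactorial l : ℝ) ≤ (k * n).descFactorial l := by
        exact_mod_cast Nat.descFactorial_le l hn
      have h2 := descFactorial_le_pow_mul_descFactorial hr0 hr1.le hrn (k * (s + 2) - l)
      have h3 : r ^ (k * (s + 2) - l) ≤ r ^ s :=
        pow_le_pow_of_le_one hr0 hr1.le (by omega)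
      rw [← Nat.descFactorial_mul_descFactorial (by omega : l ≤ k * (s + 2)), Nat.cast_mul]
      calc _ ≤ ((k * n).descFactorial l : ℝ)
            * (r ^ s * (k * n - l).descFactorial (k * (s + 2) - l)) := by
              gcongr
              exact h2.trans (by gcongr)
        _ = _ := by ring
    have hinv : 1 / (((k * (s + 2) : ℕ) : ℝ) - l) ≤ 1 := by
      rw [div_le_one (by linarith)]
      exact hd
    have hinv0 : 0 ≤ 1 / (((k * (s + 2) : ℕ) : ℝ) - l) := by
      apply div_nonneg <;> linarith
    rw [Real.norm_of_nonneg (mul_nonneg (by positivity) hinv0)]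
    exact (mul_le_mul hprob hinv hinv0 (by positivity)).trans_eq (mul_one _)

lemma sum_Icc_eq_tsum_hypergeometric (k : ℕ) (hk : 2 ≤ k) (n M : ℕ) (hM : M ≤ k * n)
    (l : ℕ) (hl : l ≤ k) :
    ∑ j ∈ Finset.Icc 1 (n-1), (M.choose l : ℝ) * (Nat.descFactorial k l : ℝ)
              * (Nat.descFactorial (k*(j-1)) (M - l) : ℝ)
            / (Nat.descFactorial (k*n) M : ℝ)
          * (1 / (((k*(n-j+1) : ℕ) : ℝ) - (l : ℝ)))
      = k.choose l * ∑' s : ℕ, (M.descFactorial l : ℝ)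
        * (k * n - M).descFactorial (k * (s + 2) - l) / (k * n).descFactorial (k * (s + 2))
        * (1 / (((k * (s + 2) : ℕ) : ℝ) - l)) := by
  rw [tsum_eq_sum (s := Finset.range (n - 1)), Finset.mul_sum]
  · refine Finset.sum_nbij' (fun j => n - 1 - j) (fun s => n - 1 - s) ?_ ?_ ?_ ?_ ?_
    · intro j hj
      simp only [Finset.mem_Icc, Finset.mem_range] at *
      omega
    · intro j hj
      simp only [Finset.mem_Icc, Finset.mem_range] at *
      omega
    · intro j hj
      simp only [Finset.mem_Icc] at *
      omega
    · intro j hj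
      simp only [Finset.mem_range] at *
      omega
    · intro j hj
      simp only [Finset.mem_Icc] at hj
      have hs : n - 1 - j + 2 = n - j + 1 := by omega
      rw [hs, choose_mul_descFactorial_comm]
      rcases lt_or_ge M l with hMl | hlM
      · simp [Nat.descFactorial_of_lt hMl]
      have hle : k * (n - j + 1) ≤ k * n := Nat.mul_le_mul_left k (by omega)
      have hsub : k * (j - 1) = k * n - k * (n - j + 1) := by
        rw [← Nat.mul_sub]
        congr 1
        omega
      have hlk : l ≤ k * (n - j + 1) := by nlinarith
      rw [hsub, mul_div_assoc, descFactorial_div_descFactorial_symm hle hM hlk hlM]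
      ring
  · intro s hs
    rw [Finset.mem_range] at hs
    have : k * n < k * (s + 2) := Nat.mul_lt_mul_of_pos_left (by omega) (by omega)
    simp [Nat.descFactorial_of_lt this]

/-- Equation (3.13): the limit of the second term of the formula of Proposition 1. -/
theorem secretary_multirank_second_term_limit (k : ℕ) (hk : 2 ≤ k) (c : ℝ)
    (hc : c ∈ Set.Ioo (0:ℝ) 1)
    (M : ℕ → ℕ) (hM : ∀ n, 1 ≤ n → 1 ≤ M n ∧ M n ≤ k*n - 1)
    (hlim : Tendsto (fun n : ℕ => (M n : ℝ) / ((k : ℝ) * n)) atTop (nhds c)) :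
    Tendsto (fun n : ℕ =>
        (k : ℝ) * ∑ j ∈ Finset.Icc 1 (n-1), ∑ l ∈ Finset.Icc 1 k,
          ((M n).choose l : ℝ) * (Nat.descFactorial k l : ℝ)
              * (Nat.descFactorial (k*(j-1)) (M n - l) : ℝ)
            / (Nat.descFactorial (k*n) (M n) : ℝ)
          * (1 / (((k*(n-j+1) : ℕ) : ℝ) - (l : ℝ)))) atTop
      (nhds ((k : ℝ) * ∑ l ∈ Finset.Icc 1 k, (k.choose l : ℝ) * (c/(1-c))^l *
        ∑' s : ℕ, (1-c)^(k*(s+2)) / (((k*(s+2) : ℕ) : ℝ) - (l : ℝ)))) := by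
  refine Tendsto.const_mul _ ?_
  have hMle : ∀ᶠ n in atTop, M n ≤ k * n := by
    filter_upwards [eventually_ge_atTop 1] with n hn
    have := (hM n hn).2
    omega
  simp_rw [Finset.sum_comm (s := Finset.Icc 1 (_ - 1))]
  refine tendsto_finsetSum _ fun l hl => ?_
  have hlk := (Finset.mem_Icc.mp hl).2
  have h1c : 1 - c ≠ 0 := by linarith [hc.2]
  have hval : (c / (1 - c)) ^ l *
      ∑' s : ℕ, (1 - c) ^ (k * (s + 2)) / (((k * (s + 2) : ℕ) : ℝ) - (l : ℝ))
      = ∑' s : ℕ, c ^ l * (1 - c) ^ (k * (s + 2) - l)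
        * (1 / (((k * (s + 2) : ℕ) : ℝ) - l)) := by
    rw [← tsum_mul_left]
    refine tsum_congr fun s => ?_
    rw [pow_sub₀ _ h1c (by nlinarith : l ≤ k * (s + 2)), div_pow]
    ring
  rw [mul_assoc, hval]
  refine ((tendsto_tsum_hypergeometric k hk c hc M hMle hlim l hlk).const_mul _).congr' ?_
  filter_upwards [hMle] with n hn
  exact (sum_Icc_eq_tsum_hypergeometric k hk n (M n) hn l hlk).symm
end
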